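/- Let m, d be integers with m ≥ d ≥ 2, N = m^d, and let θ ∈ (0, π/2) be strictly between 0 and π/2. Then the inequality between expected squared L₂-discrepancies is strict: 𝔼L₂²(P_{Ω*∼(θ)}) < 𝔼L₂²(P_{Ω*_|}). -/

import Mathlib

open MeasureTheory Real Set

noncomputable section

/-- The unit cube `[0,1]^d`. -/
def unitCube (d : ℕ) : Set (Fin d → ℝ) := Set.univ.pi fun _ => Set.Icc (0 : ℝ) 1

/-- The anchored half-open box `[0, z) = ∏ⱼ [0, zⱼ)`. -/
def lowerBox {d : ℕ} (z : Fin d → ℝ) : Set (Fin d → ℝ) := {y | ∀ i, 0 ≤ y i ∧ y i < z i}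

/-- The squared `L₂`-discrepancy of a point configuration `P` in `[0,1]^d`:
`∫_{[0,1]^d} (λ([0,z)) - (1/N) #{i : P i ∈ [0,z)})² dz`. -/
def L2sq {d : ℕ} {ι : Type} [Fintype ι] (P : ι → Fin d → ℝ) : ℝ :=
  ∫ z in unitCube d,
    ((volume (lowerBox z)).toReal
      - (Fintype.card ι : ℝ)⁻¹ * (Nat.card {i // P i ∈ lowerBox z} : ℝ)) ^ 2

/-- The joint distribution of the stratified sample associated to a partition `Ω`:
independent points, the `i`-th uniformly distributed on `Ω i`. -/
def stratified {d : ℕ} {ι : Type} [Fintype ι] (Ω : ι → Set (Fin d → ℝ)) :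
    Measure (ι → Fin d → ℝ) :=
  Measure.pi fun i => ProbabilityTheory.cond volume (Ω i)

/-- Expected squared `L₂`-discrepancy of the stratified sample from the partition `Ω`. -/
def expL2sq {d : ℕ} {ι : Type} [Fintype ι] (Ω : ι → Set (Fin d → ℝ)) : ℝ :=
  ∫ P, L2sq P ∂(stratified Ω)

/-- The rectangle `I = [0,2] × [0,1] ⊆ ℝ²`. -/
def I2 : Set (ℝ × ℝ) := Set.Icc (0 : ℝ) 2 ×ˢ Set.Icc (0 : ℝ) 1

open scoped Classical in
/-- The cell `Ω₁(θ)` of the one-parameter family of partitions of `[0,2] × [0,1]`. -/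
def Omega1 (θ : ℝ) : Set (ℝ × ℝ) :=
  if θ = π / 2 then Set.Icc (0 : ℝ) 1 ×ˢ Set.Icc (0 : ℝ) 1
  else if θ < arctan (1 / 2) then {p ∈ I2 | p.2 ≤ (1 - p.1) * tan θ + 1 / 2}
  else {p ∈ I2 | (p.1 - 1) * tan θ + p.2 ≤ 1 / 2}

/-- The cell `Ω₂(θ)`: the closure of the complement of `Ω₁(θ)` in `[0,2] × [0,1]`. -/
def Omega2 (θ : ℝ) : Set (ℝ × ℝ) := closure (I2 \ Omega1 θ)

/-- The anchor point `a = ((m-2)/m, (m-1)/m, …, (m-1)/m)`. -/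
def anchor (m d : ℕ) : Fin d → ℝ := fun j => if (j : ℕ) = 0 then ((m : ℝ) - 2) / m else ((m : ℝ) - 1) / m

/-- The two corner cells `a + (1/m)·(Ωᵢ(θ) × [0,1]^{d-2})`, `i = 1, 2`. -/
def cornerCell (m d : ℕ) (hd : 2 ≤ d) (θ : ℝ) (i : Fin 2) : Set (Fin d → ℝ) :=
  (fun x : Fin d → ℝ => fun j => anchor m d j + x j / m) ''
    {x : Fin d → ℝ |
      (x ⟨0, by omega⟩, x ⟨1, by omega⟩) ∈ (if i = 0 then Omega1 θ else Omega2 θ) ∧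
      ∀ j : Fin d, 2 ≤ (j : ℕ) → x j ∈ Set.Icc (0 : ℝ) 1}

/-- The axis-parallel grid cell of side `1/m` indexed by `k`. -/
def gridCell {d : ℕ} (m : ℕ) (k : Fin d → Fin m) : Set (Fin d → ℝ) :=
  Set.univ.pi fun j => Set.Ico ((k j : ℝ) / m) (((k j : ℝ) + 1) / m)

open scoped Classical in
/-- The partition `Ω*∼(θ)` of `[0,1]^d`: all grid cells of side `1/m` except the two
top-corner ones, which are replaced by the two cells `a + (1/m)·(Ωᵢ(θ) × [0,1]^{d-2})`. -/
def OmegaStarSim (m d : ℕ) (hd : 2 ≤ d) (θ : ℝ) : (Fin d → Fin m) → Set (Fin d → ℝ) :=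
  fun k =>
    if ∀ j : Fin d, (k j : ℕ) = (if (j : ℕ) = 0 then m - 2 else m - 1) then
      cornerCell m d hd θ 0
    else if ∀ j : Fin d, (k j : ℕ) = m - 1 then cornerCell m d hd θ 1
    else gridCell m k

end


theorem measurableSet_lowerBox_prod (d : ℕ) :
    MeasurableSet {q : (Fin d → ℝ) × (Fin d → ℝ) | q.1 ∈ lowerBox q.2} := by
  have : {q : (Fin d → ℝ) × (Fin d → ℝ) | q.1 ∈ lowerBox q.2}
      = ⋂ i, ({q | 0 ≤ q.1 i} ∩ {q | q.1 i < q.2 i}) := by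
    ext q; simp [lowerBox]
  rw [this]
  refine MeasurableSet.iInter fun i => ?_
  exact (measurableSet_le (by fun_prop) (by fun_prop)).inter
    (measurableSet_lt (by fun_prop) (by fun_prop))

theorem measurableSet_lowerBox {d : ℕ} (z : Fin d → ℝ) : MeasurableSet (lowerBox z) :=
  (measurableSet_lowerBox_prod d).preimage (measurable_id.prodMk measurable_const)

theorem lowerBox_eq_pi {d : ℕ} (z : Fin d → ℝ) :
    lowerBox z = Set.univ.pi fun i => Set.Ico 0 (z i) := by
  ext y; simp [lowerBox]

theorem lowerBox_eq_empty {d : ℕ} {z : Fin d → ℝ} (hz : ¬ ∀ i, 0 ≤ z i) : lowerBox z = ∅ :=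
  Set.eq_empty_of_forall_notMem fun _ hy => hz fun i => (hy i).1.trans (hy i).2.le

theorem volume_real_lowerBox {d : ℕ} {z : Fin d → ℝ} (hz : ∀ i, 0 ≤ z i) :
    volume.real (lowerBox z) = ∏ i, z i := by
  simp only [Measure.real, lowerBox_eq_pi, volume_pi_pi, Real.volume_Ico, sub_zero,
    ENNReal.toReal_prod]
  exact Finset.prod_congr rfl fun i _ => ENNReal.toReal_ofReal (hz i)

/-- The number of points of a configuration in a box is a sum of indicators. -/
theorem natCard_mem_lowerBox {d : ℕ} {ι : Type} [Fintype ι] (P : ι → Fin d → ℝ) (z : Fin d → ℝ) :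
    (Nat.card {i // P i ∈ lowerBox z} : ℝ) = ∑ i, (lowerBox z).indicator 1 (P i) := by
  classical
  rw [Nat.card_eq_fintype_card, Fintype.card_subtype, Finset.card_filter]
  push_cast
  exact Finset.sum_congr rfl fun i _ => by simp [Set.indicator_apply]

/-- Bias-variance decomposition of the expected squared local discrepancy of independent points. -/
theorem integral_sq_sub_sum_indicator {E ι : Type} [MeasurableSpace E] [Fintype ι]
    (μ : ι → Measure E) [∀ i, IsProbabilityMeasure (μ i)] {B : Set E} (hB : MeasurableSet B)
    (a b : ℝ) :
    ∫ P, (a - b * ∑ i, B.indicator 1 (P i)) ^ 2 ∂(Measure.pi μ)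
      = (a - b * ∑ i, (μ i).real B) ^ 2
        + b ^ 2 * ((∑ i, (μ i).real B) - ∑ i, (μ i).real B ^ 2) := by
  have hX : ∀ i, MemLp (B.indicator (1 : E → ℝ)) 2 (μ i) := fun i =>
    memLp_indicator_const 2 hB (1 : ℝ) (Or.inr (measure_ne_top _ _))
  have hXi : ∀ i, MemLp (fun P : ι → E => B.indicator (1 : E → ℝ) (P i)) 2 (Measure.pi μ) :=
    fun i => (hX i).comp_measurePreserving (measurePreserving_eval μ i)
  have hS : MemLp (fun P : ι → E => ∑ i, B.indicator (1 : E → ℝ) (P i)) 2 (Measure.pi μ) :=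
    memLp_finsetSum _ fun i _ => hXi i
  have hY : MemLp (fun P : ι → E => a - b * ∑ i, B.indicator (1 : E → ℝ) (P i)) 2
      (Measure.pi μ) := (memLp_const a).sub (hS.const_mul b)
  have hmean : ∀ i, ∫ x, B.indicator (1 : E → ℝ) x ∂(μ i) = (μ i).real B := fun i =>
    integral_indicator_one hB
  have hmeani : ∀ i, ∫ P, B.indicator (1 : E → ℝ) (P i) ∂(Measure.pi μ) = (μ i).real B :=
    fun i => by
      rw [← hmean i, ← (measurePreserving_eval μ i).map_eq,
        integral_map (measurable_pi_apply i).aemeasurable]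
      exact (measurable_one.indicator hB).aestronglyMeasurable
  have hvar : ∀ i, ProbabilityTheory.variance (B.indicator (1 : E → ℝ)) (μ i)
      = (μ i).real B - (μ i).real B ^ 2 := fun i => by
    rw [ProbabilityTheory.variance_eq_sub (hX i), hmean i]
    congr 1
    rw [← hmean i]
    refine integral_congr_ae (Filter.Eventually.of_forall fun x => ?_)
    by_cases hx : x ∈ B <;> simp [hx]
  have h1 := ProbabilityTheory.variance_eq_sub hY
  have h2 : ProbabilityTheory.variance
      (fun P : ι → E => a - b * ∑ i, B.indicator (1 : E → ℝ) (P i)) (Measure.pi μ)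
      = b ^ 2 * ∑ i, ((μ i).real B - (μ i).real B ^ 2) := by
    rw [ProbabilityTheory.variance_const_sub (hS.const_mul b).aestronglyMeasurable,
      ProbabilityTheory.variance_const_mul]
    congr 1
    have := ProbabilityTheory.variance_sum_pi hX
    simp only [hvar] at this
    rw [← this]
    congr 1
    ext P
    simp
  have h3 : ∫ P, (a - b * ∑ i, B.indicator (1 : E → ℝ) (P i)) ∂(Measure.pi μ)
      = a - b * ∑ i, (μ i).real B := by
    rw [integral_sub (integrable_const a) ((hS.const_mul b).integrable one_le_two),
      integral_const_mul, integral_finsetSum _ fun i _ => (hXi i).integrable one_le_two]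
    simp [hmeani]
  rw [h2, h3, Finset.sum_sub_distrib] at h1
  simp only [Pi.pow_apply] at h1
  linarith

/-- The expected squared local discrepancy at `z` of independent points with laws `μ i`. -/
noncomputable def localMeanSq {d : ℕ} {ι : Type} [Fintype ι] (μ : ι → Measure (Fin d → ℝ))
    (z : Fin d → ℝ) : ℝ :=
  (volume.real (lowerBox z) - (Fintype.card ι : ℝ)⁻¹ * ∑ i, (μ i).real (lowerBox z)) ^ 2
    + (Fintype.card ι : ℝ)⁻¹ ^ 2 *
      ((∑ i, (μ i).real (lowerBox z)) - ∑ i, (μ i).real (lowerBox z) ^ 2)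

theorem isCompact_unitCube (d : ℕ) : IsCompact (unitCube d) :=
  isCompact_univ_pi fun _ => isCompact_Icc

theorem measurableSet_unitCube (d : ℕ) : MeasurableSet (unitCube d) :=
  (isCompact_unitCube d).isClosed.measurableSet

theorem volume_real_lowerBox_le_one {d : ℕ} {z : Fin d → ℝ} (hz : z ∈ unitCube d) :
    volume.real (lowerBox z) ≤ 1 := by
  simp only [unitCube, Set.mem_univ_pi, Set.mem_Icc] at hz
  rw [volume_real_lowerBox fun i => (hz i).1]
  exact Finset.prod_le_one (fun i _ => (hz i).1) fun i _ => (hz i).2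

theorem integrable_local_discrepancy_sq {d : ℕ} {ι : Type} [Fintype ι]
    (μ : ι → Measure (Fin d → ℝ)) [∀ i, IsProbabilityMeasure (μ i)] :
    Integrable (Function.uncurry fun (P : ι → Fin d → ℝ) (z : Fin d → ℝ) =>
        (volume.real (lowerBox z)
          - (Fintype.card ι : ℝ)⁻¹ * ∑ i, (lowerBox z).indicator (1 : (Fin d → ℝ) → ℝ) (P i)) ^ 2)
      ((Measure.pi μ).prod (volume.restrict (unitCube d))) := by
  have : IsFiniteMeasure (volume.restrict (unitCube d)) :=
    isFiniteMeasure_restrict.2 (isCompact_unitCube d).measure_lt_top.ne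
  have hvol : Measurable fun z : Fin d → ℝ => volume.real (lowerBox z) :=
    (measurable_measure_prodMk_right (measurableSet_lowerBox_prod d)).ennreal_toReal
  have hind : ∀ i, Measurable fun q : (ι → Fin d → ℝ) × (Fin d → ℝ) =>
      (lowerBox q.2).indicator (1 : (Fin d → ℝ) → ℝ) (q.1 i) := fun i => by
    have hm : MeasurableSet {q : (ι → Fin d → ℝ) × (Fin d → ℝ) | q.1 i ∈ lowerBox q.2} :=
      (measurableSet_lowerBox_prod d).preimage
        (f := fun q : (ι → Fin d → ℝ) × (Fin d → ℝ) => (q.1 i, q.2)) (by fun_prop)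
    exact (measurable_one (α := ℝ)).indicator hm
  have hmeas : Measurable (Function.uncurry fun (P : ι → Fin d → ℝ) (z : Fin d → ℝ) =>
        (volume.real (lowerBox z)
          - (Fintype.card ι : ℝ)⁻¹ * ∑ i, (lowerBox z).indicator (1 : (Fin d → ℝ) → ℝ) (P i)) ^ 2) := by
    refine Measurable.pow_const (Measurable.sub (hvol.comp measurable_snd) ?_) 2
    exact (Finset.measurable_sum _ fun i _ => hind i).const_mul _
  refine Integrable.of_bound hmeas.aestronglyMeasurable 1 ?_
  have hz : ∀ᵐ q ∂((Measure.pi μ).prod (volume.restrict (unitCube d))), q.2 ∈ unitCube d :=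
    Measure.quasiMeasurePreserving_snd.ae (ae_restrict_mem (measurableSet_unitCube d))
  filter_upwards [hz] with q hq
  have h1 := volume_real_lowerBox_le_one hq
  have h0 : 0 ≤ volume.real (lowerBox q.2) := measureReal_nonneg
  have s0 : 0 ≤ ∑ i, (lowerBox q.2).indicator (1 : (Fin d → ℝ) → ℝ) (q.1 i) :=
    Finset.sum_nonneg fun i _ => Set.indicator_nonneg (fun _ _ => zero_le_one) _
  have s1 : ∑ i, (lowerBox q.2).indicator (1 : (Fin d → ℝ) → ℝ) (q.1 i) ≤ Fintype.card ι := by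
    refine (Finset.sum_le_card_nsmul Finset.univ _ 1 fun i _ => ?_).trans (by simp)
    exact Set.indicator_le_self' (fun _ _ => zero_le_one) _
  have t0 : 0 ≤ (Fintype.card ι : ℝ)⁻¹ * ∑ i, (lowerBox q.2).indicator (1 : (Fin d → ℝ) → ℝ)
      (q.1 i) := by
    positivity
  have t1 : (Fintype.card ι : ℝ)⁻¹ * ∑ i, (lowerBox q.2).indicator (1 : (Fin d → ℝ) → ℝ)
      (q.1 i) ≤ 1 :=
    inv_mul_le_one_of_le₀ s1 (Nat.cast_nonneg _)
  simp only [Function.uncurry, norm_pow, Real.norm_eq_abs]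
  exact pow_le_one₀ (abs_nonneg _) (abs_le.2 ⟨by linarith, by linarith⟩)

theorem integrableOn_localMeanSq {d : ℕ} {ι : Type} [Fintype ι]
    (μ : ι → Measure (Fin d → ℝ)) [∀ i, IsProbabilityMeasure (μ i)] :
    IntegrableOn (localMeanSq μ) (unitCube d) := by
  have h := (integrable_local_discrepancy_sq μ).integral_prod_right
  refine h.congr (Filter.Eventually.of_forall fun z => ?_)
  exact integral_sq_sub_sum_indicator μ (measurableSet_lowerBox z)
    (volume.real (lowerBox z)) (Fintype.card ι : ℝ)⁻¹

theorem integral_L2sq_pi {d : ℕ} {ι : Type} [Fintype ι]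
    (μ : ι → Measure (Fin d → ℝ)) [∀ i, IsProbabilityMeasure (μ i)] :
    ∫ P, L2sq P ∂(Measure.pi μ) = ∫ z in unitCube d, localMeanSq μ z := by
  simp only [L2sq, natCard_mem_lowerBox]
  refine (integral_integral_swap (integrable_local_discrepancy_sq μ)).trans ?_
  refine integral_congr_ae (Filter.Eventually.of_forall fun z => ?_)
  exact integral_sq_sub_sum_indicator μ (measurableSet_lowerBox z) _ _

/-- Two families of laws which agree off two indices `i ≠ j`, and whose sums over these two
indices agree, have expected squared discrepancies ordered as the integrals of the products of
the two exceptional distribution functions. -/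
theorem integral_L2sq_pi_lt {d : ℕ} {ι : Type} [Fintype ι]
    (μ ν : ι → Measure (Fin d → ℝ)) [∀ i, IsProbabilityMeasure (μ i)]
    [∀ i, IsProbabilityMeasure (ν i)] {i j : ι} (hij : i ≠ j)
    (hoff : ∀ k, k ≠ i → k ≠ j → μ k = ν k)
    (hsum : ∀ z ∈ unitCube d, (μ i).real (lowerBox z) + (μ j).real (lowerBox z)
      = (ν i).real (lowerBox z) + (ν j).real (lowerBox z))
    (hlt : 0 < ∫ z in unitCube d, ((ν i).real (lowerBox z) * (ν j).real (lowerBox z)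
      - (μ i).real (lowerBox z) * (μ j).real (lowerBox z))) :
    ∫ P, L2sq P ∂(Measure.pi μ) < ∫ P, L2sq P ∂(Measure.pi ν) := by
  classical
  have hsplit : ∀ f : ι → ℝ, ∑ k, f k = f i + f j + ∑ k ∈ (Finset.univ.erase i).erase j, f k := by
    intro f
    rw [add_assoc, Finset.add_sum_erase _ f (by simp [hij.symm]),
      Finset.add_sum_erase _ f (Finset.mem_univ i)]
  have : Nonempty ι := ⟨i⟩
  have hN : (0 : ℝ) < (Fintype.card ι : ℝ)⁻¹ ^ 2 := by
    have : (0 : ℝ) < Fintype.card ι := by exact_mod_cast Fintype.card_pos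
    positivity
  have key : Set.EqOn (fun z => localMeanSq ν z - localMeanSq μ z)
      (fun z => (Fintype.card ι : ℝ)⁻¹ ^ 2 * 2 * ((ν i).real (lowerBox z) * (ν j).real (lowerBox z)
      - (μ i).real (lowerBox z) * (μ j).real (lowerBox z))) (unitCube d) := by
    intro z hz
    have hrest : ∀ k ∈ (Finset.univ.erase i).erase j, μ k = ν k := fun k hk => by
      simp only [Finset.mem_erase, Finset.mem_univ, and_true] at hk
      exact hoff k hk.2 hk.1
    simp only [localMeanSq]
    rw [hsplit fun k => (μ k).real (lowerBox z), hsplit fun k => (ν k).real (lowerBox z),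
      hsplit fun k => (μ k).real (lowerBox z) ^ 2, hsplit fun k => (ν k).real (lowerBox z) ^ 2,
      hsum z hz, Finset.sum_congr (f := fun k => (μ k).real (lowerBox z)) rfl
        fun k hk => by rw [hrest k hk],
      Finset.sum_congr (f := fun k => (μ k).real (lowerBox z) ^ 2) rfl
        fun k hk => by rw [hrest k hk]]
    have : (μ i).real (lowerBox z)
      = (ν i).real (lowerBox z) + (ν j).real (lowerBox z) - (μ j).real (lowerBox z) := by
      linarith [hsum z hz]
    rw [this]
    ring
  rw [integral_L2sq_pi, integral_L2sq_pi, ← sub_pos,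
    ← integral_sub (integrableOn_localMeanSq ν) (integrableOn_localMeanSq μ)]
  rw [setIntegral_congr_fun (measurableSet_unitCube d) key, integral_const_mul]
  positivity

theorem integral_sextic (a b k₀ k₁ k₂ k₃ k₄ k₅ k₆ : ℝ) :
    ∫ x in a..b, (k₀ + k₁ * x + k₂ * x ^ 2 + k₃ * x ^ 3 + k₄ * x ^ 4 + k₅ * x ^ 5 + k₆ * x ^ 6)
      = k₀ * (b - a) + k₁ * (b ^ 2 - a ^ 2) / 2 + k₂ * (b ^ 3 - a ^ 3) / 3
        + k₃ * (b ^ 4 - a ^ 4) / 4 + k₄ * (b ^ 5 - a ^ 5) / 5 + k₅ * (b ^ 6 - a ^ 6) / 6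
        + k₆ * (b ^ 7 - a ^ 7) / 7 := by
  have hpow : ∀ n : ℕ, IntervalIntegrable (fun x : ℝ => x ^ n) volume a b := fun n =>
    (continuous_pow n).intervalIntegrable _ _
  have h1 : IntervalIntegrable (fun x : ℝ => k₁ * x) volume a b := by
    simpa using (hpow 1).const_mul k₁
  have h0 : IntervalIntegrable (fun _ : ℝ => k₀) volume a b := by simp
  have h2 := h0.add h1
  have h3 := h2.add ((hpow 2).const_mul k₂)
  have h4 := h3.add ((hpow 3).const_mul k₃)
  have h5 := h4.add ((hpow 4).const_mul k₄)
  have h6 := h5.add ((hpow 5).const_mul k₅)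
  rw [intervalIntegral.integral_add h6 ((hpow 6).const_mul k₆),
    intervalIntegral.integral_add h5 ((hpow 5).const_mul k₅),
    intervalIntegral.integral_add h4 ((hpow 4).const_mul k₄),
    intervalIntegral.integral_add h3 ((hpow 3).const_mul k₃),
    intervalIntegral.integral_add h2 ((hpow 2).const_mul k₂),
    intervalIntegral.integral_add h0 h1]
  have hid : ∫ x in a..b, k₁ * x = k₁ * ((b ^ 2 - a ^ 2) / 2) := by
    rw [intervalIntegral.integral_const_mul, integral_id]
  simp only [intervalIntegral.integral_const_mul, intervalIntegral.integral_const, integral_pow,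
    hid, smul_eq_mul]
  push_cast
  ring

/-- Integral of a function which agrees with a polynomial of degree at most six. -/
theorem integral_eq_of_eqOn_sextic {f : ℝ → ℝ} {a b : ℝ} (hab : a ≤ b)
    (k₀ k₁ k₂ k₃ k₄ k₅ k₆ : ℝ)
    (h : ∀ x ∈ Set.Icc a b, f x
      = k₀ + k₁ * x + k₂ * x ^ 2 + k₃ * x ^ 3 + k₄ * x ^ 4 + k₅ * x ^ 5 + k₆ * x ^ 6) :
    ∫ x in a..b, f x
      = k₀ * (b - a) + k₁ * (b ^ 2 - a ^ 2) / 2 + k₂ * (b ^ 3 - a ^ 3) / 3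
        + k₃ * (b ^ 4 - a ^ 4) / 4 + k₄ * (b ^ 5 - a ^ 5) / 5 + k₅ * (b ^ 6 - a ^ 6) / 6
        + k₆ * (b ^ 7 - a ^ 7) / 7 := by
  rw [← integral_sextic]
  exact intervalIntegral.integral_congr fun x hx => h x (by rwa [Set.uIcc_of_le hab] at hx)

theorem integral_tent_mul_min_ge {x : ℝ} (hx : x ∈ Set.Icc (0 : ℝ) 1) :
    5 / 48 + (x - 1 / 2) / 8 - (x - 1 / 2) ^ 2 / 4 + (x - 1 / 2) ^ 4 / 3
      ≤ ∫ u in (0 : ℝ)..1, min u (1 - u) * min u x := by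
  obtain ⟨hx0, hx1⟩ := hx
  have hii : ∀ a b : ℝ, IntervalIntegrable (fun u => min u (1 - u) * min u x) volume a b :=
    fun a b => Continuous.intervalIntegrable (by fun_prop) _ _
  rcases le_total x (1 / 2) with h | h
  · rw [← intervalIntegral.integral_add_adjacent_intervals (hii 0 x) (hii x 1),
      ← intervalIntegral.integral_add_adjacent_intervals (hii x (1 / 2)) (hii (1 / 2) 1),
      integral_eq_of_eqOn_sextic hx0 0 0 1 0 0 0 0 fun u hu => by
        rw [min_eq_left (by linarith [hu.1, hu.2]), min_eq_left hu.2]; ring,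
      integral_eq_of_eqOn_sextic h 0 x 0 0 0 0 0 fun u hu => by
        rw [min_eq_left (by linarith [hu.1, hu.2]), min_eq_right hu.1]; ring,
      integral_eq_of_eqOn_sextic (by norm_num) x (-x) 0 0 0 0 0 fun u hu => by
        rw [min_eq_right (by linarith [hu.1, hu.2]), min_eq_right (by linarith [hu.1])]; ring]
    nlinarith [mul_nonneg (pow_nonneg (sub_nonneg.2 h) 3) hx0]
  · rw [← intervalIntegral.integral_add_adjacent_intervals (hii 0 (1 / 2)) (hii (1 / 2) 1),
      ← intervalIntegral.integral_add_adjacent_intervals (hii (1 / 2) x) (hii x 1),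
      integral_eq_of_eqOn_sextic (by norm_num) 0 0 1 0 0 0 0 fun u hu => by
        rw [min_eq_left (by linarith [hu.1, hu.2]), min_eq_left (by linarith [hu.2])]; ring,
      integral_eq_of_eqOn_sextic h 0 1 (-1) 0 0 0 0 fun u hu => by
        rw [min_eq_right (by linarith [hu.1, hu.2]), min_eq_left hu.2]; ring,
      integral_eq_of_eqOn_sextic hx1 x (-x) 0 0 0 0 0 fun u hu => by
        rw [min_eq_right (by linarith [hu.1, hu.2]), min_eq_right hu.1]; ring]
    nlinarith [mul_nonneg (pow_nonneg (sub_nonneg.2 h) 3) (sub_nonneg.2 hx1)]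

theorem intervalIntegral_swap_of_continuous {F : ℝ → ℝ → ℝ} (hF : Continuous F.uncurry)
    (a b c d : ℝ) :
    ∫ x in a..b, ∫ y in c..d, F x y = ∫ y in c..d, ∫ x in a..b, F x y :=
  intervalIntegral_intervalIntegral_swap <|
    (hF.continuousOn.integrableOn_compact (isCompact_uIcc.prod isCompact_uIcc)).mono_set
      (Set.prod_mono Set.uIoc_subset_uIcc Set.uIoc_subset_uIcc)

/-- The area of the part of `[0, u) × [0, v)` to the left of the line
`x = 1 / 2 + c * (1 / 2 - y)`. -/
noncomputable def slantArea (c u v : ℝ) : ℝ := ∫ y in (0 : ℝ)..v, min u (1 / 2 + c * (1 / 2 - y))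

theorem continuous_slantArea (c : ℝ) : Continuous fun p : ℝ × ℝ => slantArea c p.1 p.2 :=
  intervalIntegral.continuous_parametric_intervalIntegral_of_continuous
    (f := fun (p : ℝ × ℝ) y => min p.1 (1 / 2 + c * (1 / 2 - y))) (by fun_prop) continuous_snd

theorem slantArea_zero (u v : ℝ) : slantArea 0 u v = v * min u (1 / 2) := by
  simp [slantArea]

theorem slantArea_one_one {c : ℝ} (hc : c ∈ Set.Icc (0 : ℝ) 1) : slantArea c 1 1 = 1 / 2 := by
  rw [slantArea, integral_eq_of_eqOn_sextic zero_le_one (1 / 2 + c / 2) (-c) 0 0 0 0 0 fun y hy => by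
    rw [min_eq_right (by nlinarith [hy.1, hy.2, hc.1, hc.2])]; ring]
  ring

theorem integral_integral_slantArea_zero :
    ∫ v in (0 : ℝ)..1, ∫ u in (0 : ℝ)..1, slantArea 0 u v * (u * v - slantArea 0 u v) = 1 / 48 := by
  have hin : ∀ v : ℝ, ∫ u in (0 : ℝ)..1, slantArea 0 u v * (u * v - slantArea 0 u v)
      = v ^ 2 / 16 := fun v => by
    simp only [slantArea_zero]
    have hii : ∀ a b : ℝ, IntervalIntegrable
        (fun u => v * min u (1 / 2) * (u * v - v * min u (1 / 2))) volume a b :=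
      fun a b => Continuous.intervalIntegrable (by fun_prop) _ _
    rw [← intervalIntegral.integral_add_adjacent_intervals (hii 0 (1 / 2)) (hii (1 / 2) 1),
      integral_eq_of_eqOn_sextic (by norm_num) 0 0 0 0 0 0 0 fun u hu => by
        rw [min_eq_left hu.2]; ring,
      integral_eq_of_eqOn_sextic (by norm_num) (-v ^ 2 / 4) (v ^ 2 / 2) 0 0 0 0 0 fun u hu => by
        rw [min_eq_right hu.1]; ring]
    ring
  simp only [hin]
  rw [integral_eq_of_eqOn_sextic zero_le_one 0 0 (1 / 16) 0 0 0 0 fun v _ => by ring]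
  norm_num

theorem integral_tent_mul_slantArea_ge {c v : ℝ} (hc : c ∈ Set.Icc (0 : ℝ) 1)
    (hv : v ∈ Set.Icc (0 : ℝ) 1) :
    5 / 48 * v + c / 16 * (1 / 4 - (1 / 2 - v) ^ 2) + c ^ 2 / 12 * ((1 / 2 - v) ^ 3 - 1 / 8)
        - c ^ 4 / 15 * ((1 / 2 - v) ^ 5 - 1 / 32)
      ≤ ∫ u in (0 : ℝ)..1, min u (1 - u) * slantArea c u v := by
  have hswap : ∫ u in (0 : ℝ)..1, min u (1 - u) * slantArea c u v
      = ∫ y in (0 : ℝ)..v, ∫ u in (0 : ℝ)..1,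
        min u (1 - u) * min u (1 / 2 + c * (1 / 2 - y)) := by
    simp only [slantArea, ← intervalIntegral.integral_const_mul]
    exact intervalIntegral_swap_of_continuous (by fun_prop) _ _ _ _
  rw [hswap]
  have hpoly : ∫ y in (0 : ℝ)..v, (5 / 48 + (c * (1 / 2 - y)) / 8 - (c * (1 / 2 - y)) ^ 2 / 4
      + (c * (1 / 2 - y)) ^ 4 / 3)
      = 5 / 48 * v + c / 16 * (1 / 4 - (1 / 2 - v) ^ 2) + c ^ 2 / 12 * ((1 / 2 - v) ^ 3 - 1 / 8)
        - c ^ 4 / 15 * ((1 / 2 - v) ^ 5 - 1 / 32) := by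
    rw [integral_eq_of_eqOn_sextic hv.1 (5 / 48 + c / 16 - c ^ 2 / 16 + c ^ 4 / 48)
      (-c / 8 + c ^ 2 / 4 - c ^ 4 / 6) (-c ^ 2 / 4 + c ^ 4 / 2) (-2 * c ^ 4 / 3) (c ^ 4 / 3) 0 0
      fun y _ => by ring]
    ring
  rw [← hpoly]
  refine intervalIntegral.integral_mono_on hv.1 (Continuous.intervalIntegrable (by fun_prop) _ _)
    (Continuous.intervalIntegrable ?_ _ _) fun y hy => ?_
  · exact intervalIntegral.continuous_parametric_intervalIntegral_of_continuous'
      (f := fun y u => min u (1 - u) * min u (1 / 2 + c * (1 / 2 - y))) (by fun_prop) 0 1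
  · have := integral_tent_mul_min_ge (x := 1 / 2 + c * (1 / 2 - y))
      ⟨by nlinarith [hy.1, hy.2, hc.1, hc.2, hv.2], by nlinarith [hy.1, hy.2, hc.1, hc.2, hv.2]⟩
    simpa using this

theorem integral_integral_slantArea_lt {c : ℝ} (hc0 : 0 < c) (hc1 : c ≤ 1) :
    ∫ v in (0 : ℝ)..1, ∫ u in (0 : ℝ)..1, slantArea c u v * (u * v - slantArea c u v) < 1 / 48 := by
  have hcont := continuous_slantArea c
  have hcontu : ∀ v, Continuous fun u => slantArea c u v := fun v =>
    hcont.comp (continuous_id.prodMk continuous_const)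
  have hcontv : ∀ u, Continuous fun v => slantArea c u v := fun u =>
    hcont.comp (continuous_const.prodMk continuous_id)
  have htent : ∀ a₀ a₁ a₂ : ℝ, ∫ u in (0 : ℝ)..1,
      (a₀ * u ^ 2 + a₁ * min u (1 - u) ^ 2 + a₂ * (u * min u (1 - u)))
      = a₀ / 3 + a₁ / 12 + a₂ / 8 := fun a₀ a₁ a₂ => by
    have hii : ∀ a b : ℝ, IntervalIntegrable (fun u =>
        a₀ * u ^ 2 + a₁ * min u (1 - u) ^ 2 + a₂ * (u * min u (1 - u))) volume a b :=
      fun a b => Continuous.intervalIntegrable (by fun_prop) _ _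
    rw [← intervalIntegral.integral_add_adjacent_intervals (hii 0 (1 / 2)) (hii (1 / 2) 1),
      integral_eq_of_eqOn_sextic (by norm_num) 0 0 (a₀ + a₁ + a₂) 0 0 0 0 fun u hu => by
        rw [min_eq_left (by linarith [hu.2])]; ring,
      integral_eq_of_eqOn_sextic (by norm_num) a₁ (-2 * a₁ + a₂) (a₀ + a₁ - a₂) 0 0 0 0
        fun u hu => by rw [min_eq_right (by linarith [hu.1])]; ring]
    ring
  have hinner : ∀ v ∈ Set.Icc (0 : ℝ) 1,
      ∫ u in (0 : ℝ)..1, slantArea c u v * (u * v - slantArea c u v)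
      ≤ v ^ 2 / 6 - v * (5 / 48 * v + c / 16 * (1 / 4 - (1 / 2 - v) ^ 2)
        + c ^ 2 / 12 * ((1 / 2 - v) ^ 3 - 1 / 8) - c ^ 4 / 15 * ((1 / 2 - v) ^ 5 - 1 / 32)) := by
    intro v hv
    have hle : ∫ u in (0 : ℝ)..1, slantArea c u v * (u * v - slantArea c u v)
        ≤ ∫ u in (0 : ℝ)..1, ((v ^ 2 / 4 * u ^ 2 + v ^ 2 / 4 * min u (1 - u) ^ 2
          + v ^ 2 / 2 * (u * min u (1 - u))) - v * (min u (1 - u) * slantArea c u v)) := by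
      refine intervalIntegral.integral_mono_on zero_le_one ?_ ?_ fun u _ => ?_
      · exact Continuous.intervalIntegrable (by fun_prop) _ _
      · exact Continuous.intervalIntegrable (by fun_prop) _ _
      · nlinarith [sq_nonneg (slantArea c u v - u * v / 2 - v * min u (1 - u) / 2)]
    rw [intervalIntegral.integral_sub (Continuous.intervalIntegrable (by fun_prop) _ _)
      (Continuous.intervalIntegrable (by fun_prop) _ _), htent,
      intervalIntegral.integral_const_mul] at hle
    have := mul_le_mul_of_nonneg_left
      (integral_tent_mul_slantArea_ge ⟨hc0.le, hc1⟩ hv) hv.1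
    linarith
  have hcont' : Continuous fun v => ∫ u in (0 : ℝ)..1,
      slantArea c u v * (u * v - slantArea c u v) :=
    intervalIntegral.continuous_parametric_intervalIntegral_of_continuous'
      (f := fun v u => slantArea c u v * (u * v - slantArea c u v)) (by
        have : Continuous fun p : ℝ × ℝ => slantArea c p.2 p.1 := hcont.comp continuous_swap
        simp only [Function.uncurry_def]
        fun_prop) 0 1
  have hle := intervalIntegral.integral_mono_on zero_le_one (hcont'.intervalIntegrable 0 1)
    (Continuous.intervalIntegrable (by fun_prop) (μ := volume) 0 1) hinner
  refine hle.trans_lt ?_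
  rw [integral_eq_of_eqOn_sextic zero_le_one 0 0
    (1 / 16 - c / 16 + c ^ 2 / 16 - c ^ 4 / 48) (c / 16 - c ^ 2 / 8 + c ^ 4 / 12)
    (c ^ 2 / 12 - c ^ 4 / 6) (c ^ 4 / 6) (-c ^ 4 / 15) fun v _ => by ring]
  have h3 : 0 < c * (1 / 96 - c / 80 + c ^ 3 / 420) := by
    refine mul_pos hc0 ?_
    nlinarith [sq_nonneg (c - 1), mul_nonneg hc0.le (sq_nonneg (c - 1)), sq_nonneg c]
  nlinarith

theorem volume_real_under_graph {g : ℝ → ℝ} (hg : Continuous g) {u v : ℝ} (hu : 0 ≤ u)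
    (hv : 0 ≤ v) (hg0 : ∀ y ∈ Set.Icc 0 v, 0 ≤ g y) :
    volume.real {p : ℝ × ℝ | p.1 ∈ Set.Ico 0 v ∧ p.2 ∈ Set.Ico 0 u ∧ p.2 ≤ g p.1}
      = ∫ y in (0 : ℝ)..v, min u (g y) := by
  have hmeas : MeasurableSet
      {p : ℝ × ℝ | p.1 ∈ Set.Ico 0 v ∧ p.2 ∈ Set.Ico 0 u ∧ p.2 ≤ g p.1} :=
    (measurableSet_Ico.preimage measurable_fst).inter
      ((measurableSet_Ico.preimage measurable_snd).inter
        (measurableSet_le measurable_snd (hg.measurable.comp measurable_fst)))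
  have hfib : ∀ y, volume (Prod.mk y ⁻¹'
      {p : ℝ × ℝ | p.1 ∈ Set.Ico 0 v ∧ p.2 ∈ Set.Ico 0 u ∧ p.2 ≤ g p.1})
      = (Set.Ico 0 v).indicator (fun y => ENNReal.ofReal (min u (g y))) y := by
    intro y
    by_cases hy : y ∈ Set.Ico 0 v
    · rw [Set.indicator_of_mem hy]
      have : Prod.mk y ⁻¹' {p : ℝ × ℝ | p.1 ∈ Set.Ico 0 v ∧ p.2 ∈ Set.Ico 0 u ∧ p.2 ≤ g p.1}
          = Set.Ico 0 u ∩ Set.Iic (g y) := by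
        ext x; simp [hy.1, hy.2]
      rw [this]
      refine le_antisymm ?_ ?_
      · refine (measure_mono (t := Set.Icc 0 (min u (g y))) ?_).trans (by simp)
        exact fun x hx => ⟨hx.1.1, le_min hx.1.2.le hx.2⟩
      · refine le_trans (by simp) (measure_mono (s := Set.Ico 0 (min u (g y))) ?_)
        exact fun x hx => ⟨⟨hx.1, hx.2.trans_le (min_le_left _ _)⟩,
          (hx.2.trans_le (min_le_right _ _)).le⟩
    · rw [Set.indicator_of_notMem hy]
      have : Prod.mk y ⁻¹' {p : ℝ × ℝ | p.1 ∈ Set.Ico 0 v ∧ p.2 ∈ Set.Ico 0 u ∧ p.2 ≤ g p.1}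
          = ∅ := by
        ext x; simp only [Set.mem_preimage, Set.mem_ofPred_eq, Set.mem_empty_iff_false, iff_false]
        exact fun h => hy h.1
      rw [this, measure_empty]
  rw [Measure.real, Measure.volume_eq_prod, Measure.prod_apply hmeas]
  simp only [hfib]
  rw [lintegral_indicator measurableSet_Ico, intervalIntegral.integral_of_le hv,
    ← integral_Ico_eq_integral_Ioc, integral_eq_lintegral_of_nonneg_ae]
  · refine ae_restrict_of_forall_mem measurableSet_Ico fun y hy => ?_
    exact le_min hu (hg0 y ⟨hy.1, hy.2.le⟩)
  · exact (continuous_const.min hg).aestronglyMeasurable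

/-- The part of the rectangle `[0,2] × [0,1]` on one side of a line through its centre. -/
def halfCell (α β : ℝ) : Set (ℝ × ℝ) := {p ∈ I2 | α * (p.1 - 1) + β * (p.2 - 1 / 2) ≤ 0}

/-- The area of the part of `A` in the box `[0, u) × [0, v)`. -/
noncomputable def boxArea (A : Set (ℝ × ℝ)) (u v : ℝ) : ℝ :=
  volume.real (A ∩ Set.Ico 0 u ×ˢ Set.Ico 0 v)

theorem Omega1_eq_halfCell {θ : ℝ} (hθ : θ ∈ Set.Ioo 0 (π / 2)) :
    Omega1 θ = halfCell (tan θ) 1 := by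
  rw [Omega1, if_neg hθ.2.ne]
  split_ifs <;> ext p <;>
    simp only [halfCell, Set.mem_ofPred_eq] <;> refine and_congr_right fun _ => ?_ <;>
    constructor <;> intro h <;> linarith

theorem Omega1_pi_div_two : Omega1 (π / 2) = halfCell 1 0 := by
  rw [Omega1, if_pos rfl]
  ext p
  simp only [halfCell, I2, Set.mem_prod, Set.mem_Icc, Set.mem_ofPred_eq]
  constructor
  · rintro ⟨⟨h1, h2⟩, h3, h4⟩
    exact ⟨⟨⟨h1, by linarith⟩, h3, h4⟩, by linarith⟩
  · rintro ⟨⟨⟨h1, h2⟩, h3, h4⟩, h5⟩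
    exact ⟨⟨h1, by linarith⟩, h3, h4⟩

theorem isClosed_I2 : IsClosed I2 := isClosed_Icc.prod isClosed_Icc

theorem isClosed_halfCell (α β : ℝ) : IsClosed (halfCell α β) :=
  isClosed_I2.inter <| isClosed_le
    (f := fun p : ℝ × ℝ => α * (p.1 - 1) + β * (p.2 - 1 / 2)) (by fun_prop) continuous_const

theorem volume_line_eq_zero {α : ℝ} (hα : 0 < α) (β : ℝ) :
    volume {p : ℝ × ℝ | α * (p.1 - 1) + β * (p.2 - 1 / 2) = 0} = 0 := by
  have hm : MeasurableSet {p : ℝ × ℝ | α * (p.1 - 1) + β * (p.2 - 1 / 2) = 0} :=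
    (isClosed_eq (by fun_prop) continuous_const).measurableSet
  rw [Measure.volume_eq_prod, Measure.prod_apply_symm hm]
  refine (lintegral_congr fun y => ?_).trans lintegral_zero
  refine Set.Subsingleton.measure_zero (fun x hx x' hx' => ?_) _
  simp only [Set.mem_preimage, Set.mem_ofPred_eq] at hx hx'
  have : α * x = α * x' := by linarith
  exact mul_left_cancel₀ hα.ne' this

theorem closure_diff_halfCell_ae_eq {α : ℝ} (hα : 0 < α) (β : ℝ) :
    closure (I2 \ halfCell α β) =ᵐ[volume] (I2 \ halfCell α β : Set (ℝ × ℝ)) := by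
  refine Filter.EventuallyLE.antisymm ?_ (Filter.Eventually.of_forall fun p hp => subset_closure hp)
  have hsub : closure (I2 \ halfCell α β)
      ⊆ {p ∈ I2 | 0 ≤ α * (p.1 - 1) + β * (p.2 - 1 / 2)} := by
    refine closure_minimal (fun p hp => ⟨hp.1, ?_⟩)
      (isClosed_I2.inter <| isClosed_le (g := fun p : ℝ × ℝ => α * (p.1 - 1) + β * (p.2 - 1 / 2))
        continuous_const (by fun_prop))
    by_contra h
    exact hp.2 ⟨hp.1, (not_le.1 h).le⟩
  have hae : ∀ᵐ p : ℝ × ℝ, p ∉ {p : ℝ × ℝ | α * (p.1 - 1) + β * (p.2 - 1 / 2) = 0} :=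
    measure_eq_zero_iff_ae_notMem.1 (volume_line_eq_zero hα β)
  filter_upwards [hae] with p hp h
  exact ⟨(hsub h).1, fun h' => hp (le_antisymm h'.2 (hsub h).2)⟩

theorem volume_I2_lt_top : volume I2 < ⊤ := (isCompact_Icc.prod isCompact_Icc).measure_lt_top

theorem boxArea_add_boxArea_closure {α : ℝ} (hα : 0 < α) (β : ℝ) {u v : ℝ}
    (hu : u ∈ Set.Icc (0 : ℝ) 2) (hv : v ∈ Set.Icc (0 : ℝ) 1) :
    boxArea (halfCell α β) u v + boxArea (closure (I2 \ halfCell α β)) u v = u * v := by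
  have h1 : boxArea (closure (I2 \ halfCell α β)) u v = boxArea (I2 \ halfCell α β) u v :=
    measureReal_congr ((closure_diff_halfCell_ae_eq hα β).inter (Filter.EventuallyEq.refl _ _))
  have h2 : Set.Ico 0 u ×ˢ Set.Ico 0 v ⊆ I2 :=
    Set.prod_mono (fun x hx => ⟨hx.1, hx.2.le.trans hu.2⟩) (fun x hx => ⟨hx.1, hx.2.le.trans hv.2⟩)
  have h3 : volume.real (Set.Ico 0 u ×ˢ Set.Ico 0 v) = u * v := by
    rw [Measure.volume_eq_prod, measureReal_prod_prod]
    simp [hu.1, hv.1]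
  have hfin : volume (Set.Ico 0 u ×ˢ Set.Ico 0 v) ≠ ⊤ :=
    ((measure_mono h2).trans_lt volume_I2_lt_top).ne
  rw [h1, ← h3, ← measureReal_inter_add_sdiff (s := Set.Ico 0 u ×ˢ Set.Ico 0 v)
    (isClosed_halfCell α β).measurableSet hfin]
  simp only [boxArea]
  congr 2
  · exact Set.inter_comm _ _
  · ext p
    simp only [Set.mem_inter_iff, Set.mem_sdiff]
    exact ⟨fun h => ⟨h.2, h.1.2⟩, fun h => ⟨⟨h2 h.1, h.2⟩, h.1⟩⟩

theorem volume_real_eq_boxArea {A : Set (ℝ × ℝ)} (hA : A ⊆ I2) :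
    volume.real A = boxArea A 2 1 := by
  have h : (I2 : Set (ℝ × ℝ)) =ᵐ[volume] Set.Ico (0 : ℝ) 2 ×ˢ Set.Ico (0 : ℝ) 1 :=
    (Measure.set_prod_ae_eq Ico_ae_eq_Icc Ico_ae_eq_Icc).symm
  have h2 : A ∩ I2 = A := Set.inter_eq_left.2 hA
  conv_lhs => rw [← h2]
  exact measureReal_congr ((Filter.EventuallyEq.refl _ _).inter h)

/-- The area of a half cell cut off by a steep line. -/
theorem boxArea_halfCell_of_steep {α β : ℝ} (hα : 0 < α) (hβ : 0 ≤ β) (hαβ : β ≤ 2 * α) {u v : ℝ}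
    (hu : u ∈ Set.Icc (0 : ℝ) 2) (hv : v ∈ Set.Icc (0 : ℝ) 1) :
    boxArea (halfCell α β) u v = 2 * slantArea (β / (2 * α)) (u / 2) v := by
  set c := β / (2 * α) with hc
  have hc0 : 0 ≤ c := by positivity
  have hc1 : c ≤ 1 := by rw [hc, div_le_one (by positivity)]; exact hαβ
  have hβc : β = 2 * α * c := by rw [hc]; field_simp
  have hswap : boxArea (halfCell α β) u v = volume.real
      {p : ℝ × ℝ | p.1 ∈ Set.Ico 0 v ∧ p.2 ∈ Set.Ico 0 u ∧ p.2 ≤ 1 + c * (1 - 2 * p.1)} := by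
    have hm : MeasurableSet (halfCell α β ∩ Set.Ico 0 u ×ˢ Set.Ico 0 v) :=
      (isClosed_halfCell α β).measurableSet.inter (measurableSet_Ico.prod measurableSet_Ico)
    rw [boxArea, Measure.volume_eq_prod,
      ← (Measure.measurePreserving_swap (μ := (volume : Measure ℝ))
        (ν := (volume : Measure ℝ))).measureReal_preimage hm.nullMeasurableSet]
    congr 1
    ext ⟨y, x⟩
    simp only [halfCell, I2, Set.mem_preimage, Prod.swap_prod_mk, Set.mem_inter_iff, Set.mem_prod,
      Set.mem_Icc, Set.mem_Ico, Set.mem_ofPred_eq]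
    have hiff : α * (x - 1) + β * (y - 1 / 2) ≤ 0 ↔ x ≤ 1 + c * (1 - 2 * y) := by
      rw [show α * (x - 1) + β * (y - 1 / 2) = α * (x - (1 + c * (1 - 2 * y))) by rw [hβc]; ring,
        ← sub_nonpos (a := x)]
      exact smul_nonpos_iff_nonpos_of_pos_left hα
    rw [hiff]
    constructor
    · rintro ⟨⟨-, h⟩, hx, hy⟩
      exact ⟨hy, hx, h⟩
    · rintro ⟨hy, hx, h⟩
      exact ⟨⟨⟨⟨hx.1, hx.2.le.trans hu.2⟩, hy.1, hy.2.le.trans hv.2⟩, h⟩, hx, hy⟩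
  rw [hswap, volume_real_under_graph (g := fun y => 1 + c * (1 - 2 * y)) (by fun_prop)
    hu.1 hv.1
    fun y hy => by nlinarith [hy.1, hy.2, hv.2], slantArea, ← intervalIntegral.integral_const_mul]
  refine intervalIntegral.integral_congr fun y _ => ?_
  rw [mul_min_of_nonneg _ _ zero_le_two]
  congr 1 <;> ring

/-- The area of a half cell cut off by a flat line. -/
theorem boxArea_halfCell_of_flat {α β : ℝ} (hα : 0 < α) (hαβ : 2 * α ≤ β) {u v : ℝ}
    (hu : u ∈ Set.Icc (0 : ℝ) 2) (hv : v ∈ Set.Icc (0 : ℝ) 1) :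
    boxArea (halfCell α β) u v = 2 * slantArea (2 * α / β) v (u / 2) := by
  have hβ : 0 < β := by linarith
  set c := 2 * α / β with hc
  have hc0 : 0 ≤ c := by positivity
  have hc1 : c ≤ 1 := by rw [hc, div_le_one (by positivity)]; exact hαβ
  have hαc : α = β * c / 2 := by rw [hc]; field_simp
  have hset : boxArea (halfCell α β) u v = volume.real
      {p : ℝ × ℝ | p.1 ∈ Set.Ico 0 u ∧ p.2 ∈ Set.Ico 0 v ∧ p.2 ≤ 1 / 2 + c * (1 / 2 - p.1 / 2)} := by
    rw [boxArea]
    congr 1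
    ext ⟨x, y⟩
    simp only [halfCell, I2, Set.mem_inter_iff, Set.mem_prod,
      Set.mem_Icc, Set.mem_Ico, Set.mem_ofPred_eq]
    have hiff : α * (x - 1) + β * (y - 1 / 2) ≤ 0 ↔ y ≤ 1 / 2 + c * (1 / 2 - x / 2) := by
      rw [show α * (x - 1) + β * (y - 1 / 2) = β * (y - (1 / 2 + c * (1 / 2 - x / 2))) by
        rw [hαc]; ring, ← sub_nonpos (a := y)]
      exact smul_nonpos_iff_nonpos_of_pos_left hβ
    rw [hiff]
    constructor
    · rintro ⟨⟨-, h⟩, hx, hy⟩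
      exact ⟨hx, hy, h⟩
    · rintro ⟨hx, hy, h⟩
      exact ⟨⟨⟨⟨hx.1, hx.2.le.trans hu.2⟩, hy.1, hy.2.le.trans hv.2⟩, h⟩, hx, hy⟩
  rw [hset, volume_real_under_graph (g := fun x => 1 / 2 + c * (1 / 2 - x / 2)) (by fun_prop)
    hv.1 hu.1
    fun y hy => by nlinarith [hy.1, hy.2, hu.2], slantArea]
  have := intervalIntegral.integral_comp_div (a := 0) (b := u)
    (fun y => min v (1 / 2 + c * (1 / 2 - y))) (two_ne_zero (α := ℝ))
  simpa using this

theorem setIntegral_rect_comp_div {F : ℝ → ℝ → ℝ} (hF : Continuous F.uncurry) :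
    ∫ p in Set.Icc (0 : ℝ) 2 ×ˢ Set.Icc (0 : ℝ) 1, F (p.1 / 2) p.2
      = 2 * ∫ v in (0 : ℝ)..1, ∫ u in (0 : ℝ)..1, F u v := by
  have hF' : Continuous fun p : ℝ × ℝ => F (p.1 / 2) p.2 :=
    hF.comp (f := fun p : ℝ × ℝ => (p.1 / 2, p.2)) (by fun_prop)
  rw [Measure.volume_eq_prod, setIntegral_prod _
    (hF'.continuousOn.integrableOn_compact (isCompact_Icc.prod isCompact_Icc))]
  simp only [integral_Icc_eq_integral_Ioc, ← intervalIntegral.integral_of_le zero_le_one,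
    ← intervalIntegral.integral_of_le (zero_le_two (α := ℝ))]
  rw [intervalIntegral.integral_comp_div (fun u => ∫ v in (0 : ℝ)..1, F u v) two_ne_zero,
    intervalIntegral_swap_of_continuous hF]
  simp

/-- The integral of the product of the distribution functions of two cells in `[0,2] × [0,1]`. -/
noncomputable def crossIntegral (A B : Set (ℝ × ℝ)) : ℝ :=
  ∫ p in Set.Icc (0 : ℝ) 2 ×ˢ Set.Icc (0 : ℝ) 1, boxArea A p.1 p.2 * boxArea B p.1 p.2

theorem halfCell_of_steep {α β : ℝ} (hα : 0 < α) (hβ : 0 ≤ β) (hαβ : β ≤ 2 * α) :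
    boxArea (halfCell α β) 2 1 = 1 ∧
    crossIntegral (halfCell α β) (closure (I2 \ halfCell α β))
      = 8 * ∫ v in (0 : ℝ)..1, ∫ u in (0 : ℝ)..1, slantArea (β / (2 * α)) u v
        * (u * v - slantArea (β / (2 * α)) u v) := by
  set c := β / (2 * α) with hc
  have hc0 : 0 ≤ c := by positivity
  have hc1 : c ≤ 1 := by rw [hc, div_le_one (by positivity)]; exact hαβ
  have hcont := continuous_slantArea c
  have hcont' : Continuous (Function.uncurry fun u v =>
      4 * (slantArea c u v * (u * v - slantArea c u v))) := by
    simp only [Function.uncurry_def]; fun_prop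
  have hEq : Set.EqOn (fun p : ℝ × ℝ => boxArea (halfCell α β) p.1 p.2
      * boxArea (closure (I2 \ halfCell α β)) p.1 p.2)
      (fun p => 4 * (slantArea c (p.1 / 2) p.2 * (p.1 / 2 * p.2 - slantArea c (p.1 / 2) p.2)))
      (Set.Icc (0 : ℝ) 2 ×ˢ Set.Icc (0 : ℝ) 1) := fun p hp => by
    have h1 := boxArea_add_boxArea_closure hα β hp.1 hp.2
    have h2 := boxArea_halfCell_of_steep hα hβ hαβ hp.1 hp.2
    simp only
    rw [eq_sub_of_add_eq' h1, h2]
    ring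
  have hm : MeasurableSet (Set.Icc (0 : ℝ) 2 ×ˢ Set.Icc (0 : ℝ) 1) :=
    measurableSet_Icc.prod measurableSet_Icc
  refine ⟨?_, ?_⟩
  · rw [boxArea_halfCell_of_steep hα hβ hαβ ⟨zero_le_two, le_rfl⟩ ⟨zero_le_one, le_rfl⟩,
      div_self two_ne_zero, slantArea_one_one ⟨hc0, hc1⟩]
    norm_num
  · rw [crossIntegral, setIntegral_congr_fun hm hEq, setIntegral_rect_comp_div hcont']
    simp only [intervalIntegral.integral_const_mul]
    ring

theorem halfCell_of_flat {α β : ℝ} (hα : 0 < α) (hαβ : 2 * α ≤ β) :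
    boxArea (halfCell α β) 2 1 = 1 ∧
    crossIntegral (halfCell α β) (closure (I2 \ halfCell α β))
      = 8 * ∫ v in (0 : ℝ)..1, ∫ u in (0 : ℝ)..1, slantArea (2 * α / β) u v
        * (u * v - slantArea (2 * α / β) u v) := by
  have hβ : 0 < β := by linarith
  set c := 2 * α / β with hc
  have hc0 : 0 ≤ c := by positivity
  have hc1 : c ≤ 1 := by rw [hc, div_le_one (by positivity)]; exact hαβ
  have hcont := continuous_slantArea c
  have hcontswap : Continuous fun p : ℝ × ℝ => slantArea c p.2 p.1 := hcont.comp continuous_swap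
  have hcont' : Continuous (Function.uncurry fun u v =>
      4 * (slantArea c v u * (v * u - slantArea c v u))) := by
    simp only [Function.uncurry_def]; fun_prop
  have hEq : Set.EqOn (fun p : ℝ × ℝ => boxArea (halfCell α β) p.1 p.2
      * boxArea (closure (I2 \ halfCell α β)) p.1 p.2)
      (fun p => 4 * (slantArea c p.2 (p.1 / 2) * (p.2 * (p.1 / 2) - slantArea c p.2 (p.1 / 2))))
      (Set.Icc (0 : ℝ) 2 ×ˢ Set.Icc (0 : ℝ) 1) := fun p hp => by
    have h1 := boxArea_add_boxArea_closure hα β hp.1 hp.2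
    have h2 := boxArea_halfCell_of_flat hα hαβ hp.1 hp.2
    simp only
    rw [eq_sub_of_add_eq' h1, h2]
    ring
  have hm : MeasurableSet (Set.Icc (0 : ℝ) 2 ×ˢ Set.Icc (0 : ℝ) 1) :=
    measurableSet_Icc.prod measurableSet_Icc
  refine ⟨?_, ?_⟩
  · rw [boxArea_halfCell_of_flat hα hαβ ⟨zero_le_two, le_rfl⟩ ⟨zero_le_one, le_rfl⟩,
      div_self two_ne_zero, slantArea_one_one ⟨hc0, hc1⟩]
    norm_num
  · rw [crossIntegral, setIntegral_congr_fun hm hEq, setIntegral_rect_comp_div hcont',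
      intervalIntegral_swap_of_continuous (by
        simp only [Function.uncurry_def]; fun_prop)]
    simp only [intervalIntegral.integral_const_mul]
    ring

/-- A pair of cells in `[0,2] × [0,1]` of area one, whose distribution functions sum to that of
the rectangle. -/
structure IsBisection (A B : Set (ℝ × ℝ)) : Prop where
  measurableSet_left : MeasurableSet A
  measurableSet_right : MeasurableSet B
  subset_left : A ⊆ I2
  subset_right : B ⊆ I2
  volume_left : volume.real A = 1
  volume_right : volume.real B = 1
  boxArea_add : ∀ u ∈ Set.Icc (0 : ℝ) 2, ∀ v ∈ Set.Icc (0 : ℝ) 1,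
    boxArea A u v + boxArea B u v = u * v

theorem isBisection_halfCell {α β : ℝ} (hα : 0 < α) (hβ : 0 ≤ β) :
    IsBisection (halfCell α β) (closure (I2 \ halfCell α β)) := by
  have h : boxArea (halfCell α β) 2 1 = 1 := by
    rcases le_total β (2 * α) with h | h
    · exact (halfCell_of_steep hα hβ h).1
    · exact (halfCell_of_flat hα h).1
  have hsub : closure (I2 \ halfCell α β) ⊆ I2 := closure_minimal Set.sdiff_subset isClosed_I2
  have hadd := boxArea_add_boxArea_closure hα β (u := 2) (v := 1) ⟨zero_le_two, le_rfl⟩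
    ⟨zero_le_one, le_rfl⟩
  exact
    { measurableSet_left := (isClosed_halfCell α β).measurableSet
      measurableSet_right := isClosed_closure.measurableSet
      subset_left := fun p hp => hp.1
      subset_right := hsub
      volume_left := by rw [volume_real_eq_boxArea fun p hp => hp.1, h]
      volume_right := by rw [volume_real_eq_boxArea hsub]; linarith [h]
      boxArea_add := fun u hu v hv => boxArea_add_boxArea_closure hα β hu hv }

theorem isBisection_Omega {θ : ℝ} (hθ : θ ∈ Set.Ioc 0 (π / 2)) :
    IsBisection (Omega1 θ) (Omega2 θ) := by
  rw [Omega2]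
  rcases hθ.2.lt_or_eq with h | h
  · rw [Omega1_eq_halfCell ⟨hθ.1, h⟩]
    exact isBisection_halfCell (tan_pos_of_pos_of_lt_pi_div_two hθ.1 h) zero_le_one
  · rw [h, Omega1_pi_div_two]
    exact isBisection_halfCell one_pos le_rfl

theorem crossIntegral_Omega_lt {θ : ℝ} (hθ : θ ∈ Set.Ioo 0 (π / 2)) :
    crossIntegral (Omega1 θ) (Omega2 θ) < crossIntegral (Omega1 (π / 2)) (Omega2 (π / 2)) := by
  have ht : 0 < tan θ := tan_pos_of_pos_of_lt_pi_div_two hθ.1 hθ.2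
  rw [Omega2, Omega2, Omega1_eq_halfCell hθ, Omega1_pi_div_two,
    (halfCell_of_steep one_pos le_rfl (by norm_num)).2]
  rw [mul_one, zero_div, integral_integral_slantArea_zero]
  rcases le_total 1 (2 * tan θ) with h | h
  · rw [(halfCell_of_steep ht zero_le_one h).2]
    refine mul_lt_mul_of_pos_left (integral_integral_slantArea_lt (by positivity) ?_) (by norm_num)
    rwa [div_le_one (by positivity)]
  · rw [(halfCell_of_flat ht h).2]
    refine mul_lt_mul_of_pos_left (integral_integral_slantArea_lt (by positivity) ?_) (by norm_num)
    rwa [div_one]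

/-- The prism `A × [0,1]^n` in `ℝ^(n+2)` over a planar set `A`. -/
def prism (n : ℕ) (A : Set (ℝ × ℝ)) : Set (Fin (n + 2) → ℝ) :=
  {x | (x 0, x 1) ∈ A ∧ ∀ j : Fin (n + 2), 2 ≤ (j : ℕ) → x j ∈ Set.Icc (0 : ℝ) 1}

/-- Splitting off the first two coordinates. -/
def splitTwo (n : ℕ) (x : Fin (n + 2) → ℝ) : (ℝ × ℝ) × (Fin n → ℝ) :=
  ((x 0, x 1), fun i => x i.succ.succ)

theorem splitTwo_eq (n : ℕ) : splitTwo n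
    = (((MeasurableEquiv.piFinSuccAbove (fun _ : Fin (n + 2) => ℝ) 0).trans
      ((MeasurableEquiv.refl ℝ).prodCongr
        (MeasurableEquiv.piFinSuccAbove (fun _ : Fin (n + 1) => ℝ) 0))).trans
      MeasurableEquiv.prodAssoc.symm) := by
  ext x <;> rfl

theorem measurableEmbedding_splitTwo (n : ℕ) : MeasurableEmbedding (splitTwo n) := by
  rw [splitTwo_eq]
  exact MeasurableEquiv.measurableEmbedding _

theorem measurePreserving_splitTwo (n : ℕ) : MeasurePreserving (splitTwo n) := by
  rw [splitTwo_eq]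
  refine ((volume_preserving_piFinSuccAbove (fun _ : Fin (n + 2) => ℝ) 0).trans
    ((MeasurePreserving.id volume).prod
      (volume_preserving_piFinSuccAbove (fun _ : Fin (n + 1) => ℝ) 0))).trans ?_
  exact volume_preserving_prodAssoc.symm _

theorem prism_eq_preimage (n : ℕ) (A : Set (ℝ × ℝ)) :
    prism n A = splitTwo n ⁻¹' (A ×ˢ unitCube n) := by
  ext x
  simp only [prism, splitTwo, unitCube, Set.mem_ofPred_eq, Set.mem_preimage, Set.mem_prod,
    Set.mem_univ_pi]
  refine and_congr_right fun _ => ⟨fun h i => h _ (by simp), fun h j hj => ?_⟩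
  obtain ⟨k, rfl⟩ := Fin.exists_succ_eq.2 (show j ≠ 0 by rintro rfl; simp at hj)
  obtain ⟨i, rfl⟩ := Fin.exists_succ_eq.2 (show k ≠ 0 by rintro rfl; simp at hj)
  exact h i

theorem lowerBox_eq_preimage {n : ℕ} (w : Fin (n + 2) → ℝ) :
    lowerBox w = splitTwo n ⁻¹' ((Set.Ico 0 (w 0) ×ˢ Set.Ico 0 (w 1))
      ×ˢ lowerBox fun i => w i.succ.succ) := by
  ext x
  simp only [lowerBox, splitTwo, Set.mem_ofPred_eq, Set.mem_preimage, Set.mem_prod, Set.mem_Ico,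
    Fin.forall_fin_succ (n := n + 1), Fin.forall_fin_succ (n := n), and_assoc]
  rfl

theorem measurableSet_prism (n : ℕ) {A : Set (ℝ × ℝ)} (hA : MeasurableSet A) :
    MeasurableSet (prism n A) := by
  rw [prism_eq_preimage]
  exact (measurableEmbedding_splitTwo n).measurable (hA.prod (measurableSet_unitCube n))

theorem volume_real_preimage_splitTwo (n : ℕ) (A : Set (ℝ × ℝ)) (B : Set (Fin n → ℝ)) :
    volume.real (splitTwo n ⁻¹' (A ×ˢ B)) = volume.real A * volume.real B := by
  rw [Measure.real, (measurePreserving_splitTwo n).measure_preimage_emb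
    (measurableEmbedding_splitTwo n), ← Measure.real, Measure.volume_eq_prod,
    measureReal_prod_prod]

theorem volume_real_prism (n : ℕ) (A : Set (ℝ × ℝ)) :
    volume.real (prism n A) = volume.real A := by
  rw [prism_eq_preimage, volume_real_preimage_splitTwo]
  rw [unitCube, Measure.real, Measure.real, volume_pi_pi]
  simp

theorem volume_real_prism_inter_lowerBox {n : ℕ} (A : Set (ℝ × ℝ)) {w : Fin (n + 2) → ℝ}
    (hw : w ∈ prism n I2) :
    volume.real (prism n A ∩ lowerBox w)
      = boxArea A (w 0) (w 1) * ∏ i : Fin n, w i.succ.succ := by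
  have hw' : ∀ i : Fin n, w i.succ.succ ∈ Set.Icc (0 : ℝ) 1 := fun i => hw.2 _ (by simp)
  have hsub : unitCube n ∩ lowerBox (fun i => w i.succ.succ) = lowerBox fun i => w i.succ.succ :=
    Set.inter_eq_right.2 fun y hy i _ => ⟨(hy i).1, ((hy i).2.trans_le (hw' i).2).le⟩
  rw [prism_eq_preimage, lowerBox_eq_preimage, ← Set.preimage_inter, Set.prod_inter_prod, hsub,
    volume_real_preimage_splitTwo, volume_real_lowerBox fun i => (hw' i).1, boxArea]

theorem integral_prism_mul_prod_sq (n : ℕ) {A : Set (ℝ × ℝ)} (K : ℝ × ℝ → ℝ) :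
    ∫ w in prism n A, K (w 0, w 1) * (∏ i : Fin n, w i.succ.succ) ^ 2
      = (∫ p in A, K p) * (1 / 3) ^ n := by
  have hcube : ∫ y in unitCube n, (∏ i, y i) ^ 2 = (1 / 3) ^ n := by
    simp only [← Finset.prod_pow]
    rw [unitCube, volume_pi, Measure.restrict_pi_pi,
      integral_fintype_prod_eq_pow (fun x : ℝ => x ^ 2)]
    rw [integral_Icc_eq_integral_Ioc, ← intervalIntegral.integral_of_le zero_le_one, integral_pow]
    norm_num
  rw [← hcube, ← setIntegral_prod_mul, ← Measure.volume_eq_prod, prism_eq_preimage]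
  exact (measurePreserving_splitTwo n).setIntegral_preimage_emb (measurableEmbedding_splitTwo n)
    (fun q => K q.1 * (∏ i, q.2 i) ^ 2) _

/-- The homothety which carries `[0,2] × [0,1]^(d-1)` to the two top-corner grid cubes. -/
noncomputable def toCorner (m d : ℕ) (x : Fin d → ℝ) : Fin d → ℝ := fun j => anchor m d j + x j / m

theorem toCorner_eq (m d : ℕ) (x : Fin d → ℝ) :
    toCorner m d x = anchor m d + (m : ℝ)⁻¹ • x := by
  ext j; simp [toCorner, div_eq_inv_mul]

theorem toCorner_bijective {m : ℕ} (hm : 0 < m) (d : ℕ) : Function.Bijective (toCorner m d) := by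
  have hm' : (m : ℝ) ≠ 0 := by positivity
  refine Function.bijective_iff_has_inverse.2
    ⟨fun z => (m : ℝ) • (z - anchor m d), fun x => ?_, fun z => ?_⟩
  · simp [toCorner_eq, smul_smul, hm']
  · simp [toCorner_eq, smul_smul, hm']

theorem volume_image_toCorner (m d : ℕ) (S : Set (Fin d → ℝ)) :
    volume (toCorner m d '' S) = ENNReal.ofReal (((m : ℝ) ^ d)⁻¹) * volume S := by
  have h : toCorner m d = (anchor m d + ·) ∘ ((m : ℝ)⁻¹ • ·) := funext fun x => toCorner_eq m d x
  rw [h, Set.image_comp, Set.image_add_left, measure_preimage_add, Set.image_smul,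
    Measure.addHaar_smul]
  simp [abs_of_nonneg]

theorem anchor_nonneg {m : ℕ} (hm : 2 ≤ m) (d : ℕ) (j : Fin d) : 0 ≤ anchor m d j := by
  have hm' : (2 : ℝ) ≤ m := by exact_mod_cast hm
  unfold anchor
  split_ifs
  · exact div_nonneg (by linarith) (by linarith)
  · exact div_nonneg (by linarith) (by linarith)

theorem prism_nonneg {n : ℕ} {A : Set (ℝ × ℝ)} (hA : A ⊆ I2) {x : Fin (n + 2) → ℝ}
    (hx : x ∈ prism n A) (j : Fin (n + 2)) : 0 ≤ x j := by
  have h := hA hx.1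
  refine Fin.cases h.1.1 (fun k => Fin.cases h.2.1 (fun i => ?_) k) j
  exact (hx.2 _ (by simp)).1

theorem image_toCorner_prism_inter_lowerBox {m n : ℕ} (hm : 2 ≤ m) {A : Set (ℝ × ℝ)}
    (hA : A ⊆ I2) (w : Fin (n + 2) → ℝ) :
    toCorner m (n + 2) '' prism n A ∩ lowerBox (toCorner m (n + 2) w)
      = toCorner m (n + 2) '' (prism n A ∩ lowerBox w) := by
  have hm' : (0 : ℝ) < m := by exact_mod_cast (by omega : 0 < m)
  have h : ∀ x ∈ prism n A, toCorner m (n + 2) x ∈ lowerBox (toCorner m (n + 2) w)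
      ↔ x ∈ lowerBox w := fun x hx => by
    refine forall_congr' fun j => ?_
    have h0 := prism_nonneg hA hx j
    have h1 : 0 ≤ toCorner m (n + 2) x j := add_nonneg (anchor_nonneg hm _ j) (by positivity)
    rw [and_iff_right h0, and_iff_right h1]
    simp only [toCorner, add_lt_add_iff_left, div_lt_div_iff_of_pos_right hm']
  ext z
  constructor
  · rintro ⟨⟨x, hx, rfl⟩, hz⟩
    exact ⟨x, ⟨hx, (h x hx).1 hz⟩, rfl⟩
  · rintro ⟨x, ⟨hx, hxw⟩, rfl⟩
    exact ⟨⟨x, hx, rfl⟩, (h x hx).2 hxw⟩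

theorem volume_prism_of_volume_real_eq_one (n : ℕ) {A : Set (ℝ × ℝ)} (hA : volume.real A = 1) :
    volume (prism n A) = 1 := by
  have h := (volume_real_prism n A).trans hA
  rwa [Measure.real, ENNReal.toReal_eq_one_iff] at h

theorem volume_corner_prism (m n : ℕ) {A : Set (ℝ × ℝ)} (hA : volume.real A = 1) :
    volume (toCorner m (n + 2) '' prism n A) = ENNReal.ofReal (((m : ℝ) ^ (n + 2))⁻¹) := by
  rw [volume_image_toCorner, volume_prism_of_volume_real_eq_one n hA, mul_one]

theorem measurableSet_corner_prism (m n : ℕ) {A : Set (ℝ × ℝ)}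
    (hA : MeasurableSet A) : MeasurableSet (toCorner m (n + 2) '' prism n A) := by
  have h : toCorner m (n + 2) = (anchor m (n + 2) + ·) ∘ ((m : ℝ)⁻¹ • ·) :=
    funext fun x => toCorner_eq m _ x
  rw [h, Set.image_comp, Set.image_smul, Set.image_add_left]
  exact ((measurableSet_prism n hA).const_smul₀ _).preimage (measurable_const_add _)

theorem cond_corner_prism_real_lowerBox {m n : ℕ} (hm : 2 ≤ m) {A : Set (ℝ × ℝ)}
    (hA : MeasurableSet A) (hsub : A ⊆ I2) (hvol : volume.real A = 1) (w : Fin (n + 2) → ℝ) :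
    (ProbabilityTheory.cond volume (toCorner m (n + 2) '' prism n A)).real
      (lowerBox (toCorner m (n + 2) w)) = volume.real (prism n A ∩ lowerBox w) := by
  have hm' : (0 : ℝ) < m := by exact_mod_cast (by omega : 0 < m)
  have hc : (0 : ℝ) < ((m : ℝ) ^ (n + 2))⁻¹ := by positivity
  rw [Measure.real, ProbabilityTheory.cond_apply (measurableSet_corner_prism m n hA),
    image_toCorner_prism_inter_lowerBox hm hsub, volume_corner_prism m n hvol,
    volume_image_toCorner, ← mul_assoc,
    ENNReal.inv_mul_cancel (by simpa using hc) ENNReal.ofReal_ne_top, one_mul, Measure.real]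

theorem integral_comp_toCorner {m : ℕ} (d : ℕ) (hm : 0 < m) (f g : (Fin d → ℝ) → ℝ)
    (h : ∀ w, f (toCorner m d w) = g w) :
    ∫ z, f z = ((m : ℝ) ^ d)⁻¹ * ∫ w, g w := by
  have hm' : (m : ℝ) ≠ 0 := by positivity
  simp only [← h, toCorner_eq]
  rw [Measure.integral_comp_smul volume (fun x => f (anchor m d + x)), integral_add_left_eq_self]
  simp [hm']

theorem toCorner_mem_unitCube {m n : ℕ} (hm : 2 ≤ m) {w : Fin (n + 2) → ℝ}
    (hw : ∀ j, 0 ≤ w j) : toCorner m (n + 2) w ∈ unitCube (n + 2) ↔ w ∈ prism n I2 := by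
  have hm' : (2 : ℝ) ≤ m := by exact_mod_cast hm
  have h0 : ∀ j, 0 ≤ toCorner m (n + 2) w j := fun j =>
    add_nonneg (anchor_nonneg hm _ j) (div_nonneg (hw j) (by linarith))
  have key : ∀ j, toCorner m (n + 2) w j ≤ 1 ↔ w j ≤ if (j : ℕ) = 0 then 2 else 1 := fun j => by
    simp only [toCorner, anchor]
    split_ifs
    · rw [← add_div, div_le_one (by linarith)]
      constructor <;> intro <;> linarith
    · rw [← add_div, div_le_one (by linarith)]
      constructor <;> intro <;> linarith
  simp only [unitCube, Set.mem_univ_pi, Set.mem_Icc, h0, true_and, key, prism, I2,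
    Set.mem_ofPred_eq, Set.mem_prod, hw]
  constructor
  · intro h
    refine ⟨⟨by simpa using h 0, by simpa using h 1⟩, fun j hj => ?_⟩
    simpa [show (j : ℕ) ≠ 0 by omega] using h j
  · rintro ⟨⟨h1, h2⟩, h3⟩ j
    rcases Nat.lt_or_ge (j : ℕ) 2 with hj | hj
    · interval_cases hj' : (j : ℕ)
      · obtain rfl : j = 0 := Fin.ext hj'
        simpa using h1
      · obtain rfl : j = 1 := Fin.ext hj'
        simpa using h2
    · simpa [show (j : ℕ) ≠ 0 by omega] using h3 j hj

theorem integrableOn_real_lowerBox_mul {d : ℕ} (μ ν : Measure (Fin d → ℝ))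
    [IsProbabilityMeasure μ] [IsProbabilityMeasure ν] :
    IntegrableOn (fun z => μ.real (lowerBox z) * ν.real (lowerBox z)) (unitCube d) := by
  have hmeas : ∀ (ρ : Measure (Fin d → ℝ)) [IsProbabilityMeasure ρ],
      Measurable fun z => ρ.real (lowerBox z) := fun ρ _ =>
    (measurable_measure_prodMk_right (measurableSet_lowerBox_prod d)).ennreal_toReal
  refine Measure.integrableOn_of_bounded (M := 1) (isCompact_unitCube d).measure_lt_top.ne
    ((hmeas μ).mul (hmeas ν)).aestronglyMeasurable (Filter.Eventually.of_forall fun z => ?_)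
  rw [norm_mul, Real.norm_of_nonneg measureReal_nonneg, Real.norm_of_nonneg measureReal_nonneg]
  exact mul_le_one₀ measureReal_le_one measureReal_nonneg measureReal_le_one

/-- The uniform distribution on the corner cell over the planar cell `A`. -/
noncomputable def cornerLaw (m n : ℕ) (A : Set (ℝ × ℝ)) : Measure (Fin (n + 2) → ℝ) :=
  ProbabilityTheory.cond volume (toCorner m (n + 2) '' prism n A)

theorem isProbabilityMeasure_cornerLaw {m : ℕ} (n : ℕ) (hm : 0 < m) {A : Set (ℝ × ℝ)}
    (hA : volume.real A = 1) : IsProbabilityMeasure (cornerLaw m n A) := by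
  refine ProbabilityTheory.cond_isProbabilityMeasure_of_finite ?_ ?_
  · rw [volume_corner_prism m n hA]
    simp only [ne_eq, ENNReal.ofReal_eq_zero, not_le]
    positivity
  · rw [volume_corner_prism m n hA]
    exact ENNReal.ofReal_ne_top

theorem cornerLaw_real_add {m n : ℕ} (hm : 2 ≤ m) {A B A' B' : Set (ℝ × ℝ)}
    (h : IsBisection A B) (h' : IsBisection A' B') {z : Fin (n + 2) → ℝ}
    (hz : z ∈ unitCube (n + 2)) :
    (cornerLaw m n A).real (lowerBox z) + (cornerLaw m n B).real (lowerBox z)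
      = (cornerLaw m n A').real (lowerBox z) + (cornerLaw m n B').real (lowerBox z) := by
  obtain ⟨w, rfl⟩ := (toCorner_bijective (by omega : 0 < m) (n + 2)).2 z
  simp only [cornerLaw,
    cond_corner_prism_real_lowerBox hm h.measurableSet_left h.subset_left h.volume_left,
    cond_corner_prism_real_lowerBox hm h.measurableSet_right h.subset_right h.volume_right,
    cond_corner_prism_real_lowerBox hm h'.measurableSet_left h'.subset_left h'.volume_left,
    cond_corner_prism_real_lowerBox hm h'.measurableSet_right h'.subset_right h'.volume_right]
  by_cases hw : ∀ j, 0 ≤ w j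
  · have hwI := (toCorner_mem_unitCube hm hw).1 hz
    simp only [volume_real_prism_inter_lowerBox _ hwI, ← add_mul]
    rw [h.boxArea_add _ hwI.1.1 _ hwI.1.2, h'.boxArea_add _ hwI.1.1 _ hwI.1.2]
  · simp [lowerBox_eq_empty hw]

theorem integral_cornerLaw_mul {m n : ℕ} (hm : 2 ≤ m) {A B : Set (ℝ × ℝ)}
    (h : IsBisection A B) :
    ∫ z in unitCube (n + 2),
        (cornerLaw m n A).real (lowerBox z) * (cornerLaw m n B).real (lowerBox z)
      = ((m : ℝ) ^ (n + 2))⁻¹ * (crossIntegral A B * (1 / 3) ^ n) := by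
  have hI : MeasurableSet (prism n I2) := measurableSet_prism n isClosed_I2.measurableSet
  rw [crossIntegral, ← I2, ← integral_prism_mul_prod_sq n
      (fun p => boxArea A p.1 p.2 * boxArea B p.1 p.2),
    ← integral_indicator (measurableSet_unitCube _), ← integral_indicator hI]
  refine integral_comp_toCorner _ (by omega) _ _ fun w => ?_
  by_cases hw : ∀ j, 0 ≤ w j
  · by_cases hwI : w ∈ prism n I2
    · rw [Set.indicator_of_mem hwI, Set.indicator_of_mem ((toCorner_mem_unitCube hm hw).2 hwI)]
      simp only [cornerLaw,
        cond_corner_prism_real_lowerBox hm h.measurableSet_left h.subset_left h.volume_left,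
        cond_corner_prism_real_lowerBox hm h.measurableSet_right h.subset_right h.volume_right,
        volume_real_prism_inter_lowerBox _ hwI]
      ring
    · rw [Set.indicator_of_notMem hwI,
        Set.indicator_of_notMem (mt (toCorner_mem_unitCube hm hw).1 hwI)]
  · rw [Set.indicator_of_notMem fun hwI => hw (prism_nonneg subset_rfl hwI)]
    refine Set.indicator_apply_eq_zero.2 fun _ => ?_
    rw [cornerLaw,
      cond_corner_prism_real_lowerBox hm h.measurableSet_left h.subset_left h.volume_left]
    simp [lowerBox_eq_empty hw]

theorem isProbabilityMeasure_cond_gridCell {d m : ℕ} (k : Fin d → Fin m) :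
    IsProbabilityMeasure (ProbabilityTheory.cond volume (gridCell m k)) := by
  have hvol : volume (gridCell m k) = ∏ _j : Fin d, ENNReal.ofReal (1 / m) := by
    rw [gridCell, volume_pi_pi]
    refine Finset.prod_congr rfl fun j _ => ?_
    rw [Real.volume_Ico]
    congr 1
    ring
  have hpos : ∀ j ∈ (Finset.univ : Finset (Fin d)), ENNReal.ofReal (1 / (m : ℝ)) ≠ 0 :=
    fun j _ => by
      have : 0 < m := (k j).pos
      simp only [ne_eq, ENNReal.ofReal_eq_zero, not_le]
      positivity
  refine ProbabilityTheory.cond_isProbabilityMeasure_of_finite ?_ ?_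
  · rw [hvol]
    exact Finset.prod_ne_zero_iff.2 hpos
  · rw [hvol]
    exact ENNReal.prod_ne_top fun _ _ => ENNReal.ofReal_ne_top

theorem cond_cornerCell_zero (m n : ℕ) (hd : 2 ≤ n + 2) (θ : ℝ) :
    ProbabilityTheory.cond volume (cornerCell m (n + 2) hd θ 0) = cornerLaw m n (Omega1 θ) := by
  rfl

theorem cond_cornerCell_one (m n : ℕ) (hd : 2 ≤ n + 2) (θ : ℝ) :
    ProbabilityTheory.cond volume (cornerCell m (n + 2) hd θ 1) = cornerLaw m n (Omega2 θ) := by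
  rfl

theorem isProbabilityMeasure_cond_OmegaStarSim {m n : ℕ} (hm : 0 < m) (hd : 2 ≤ n + 2) {θ : ℝ}
    (hθ : θ ∈ Set.Ioc 0 (π / 2)) (k : Fin (n + 2) → Fin m) :
    IsProbabilityMeasure (ProbabilityTheory.cond volume (OmegaStarSim m (n + 2) hd θ k)) := by
  rw [OmegaStarSim]
  split_ifs
  · rw [cond_cornerCell_zero]
    exact isProbabilityMeasure_cornerLaw n hm (isBisection_Omega hθ).volume_left
  · rw [cond_cornerCell_one]
    exact isProbabilityMeasure_cornerLaw n hm (isBisection_Omega hθ).volume_right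
  · exact isProbabilityMeasure_cond_gridCell k

/-- For integers `m ≥ d ≥ 2`, `N = m^d`, and `θ` strictly between `0` and
`π/2`, the expected squared `L₂`-discrepancy of the stratified sample from `Ω*∼(θ)` is
strictly smaller than that of jittered sampling (the grid partition `Ω*_| = Ω*∼(π/2)`). -/
theorem expL2sq_OmegaStarSim_lt_jittered (m d : ℕ) (hd : 2 ≤ d) (hm : d ≤ m)
    (θ : ℝ) (hθ : θ ∈ Set.Ioo 0 (π / 2)) :
    expL2sq (OmegaStarSim m d hd θ) < expL2sq (OmegaStarSim m d hd (π / 2)) := by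
  obtain ⟨n, rfl⟩ : ∃ n, d = n + 2 := ⟨d - 2, by omega⟩
  have hm2 : 2 ≤ m := hd.trans hm
  have hθ' : θ ∈ Set.Ioc 0 (π / 2) := ⟨hθ.1, hθ.2.le⟩
  have hπ : π / 2 ∈ Set.Ioc 0 (π / 2) := ⟨by positivity, le_rfl⟩
  have hb := isBisection_Omega hθ'
  have hb' := isBisection_Omega hπ
  let i : Fin (n + 2) → Fin m := fun j =>
    if (j : ℕ) = 0 then ⟨m - 2, by omega⟩ else ⟨m - 1, by omega⟩
  let l : Fin (n + 2) → Fin m := fun _ => ⟨m - 1, by omega⟩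
  have hil : i ≠ l := fun h => by
    have := congrArg Fin.val (congrFun h 0)
    simp only [i, l, Fin.val_zero, if_true] at this
    omega
  have hi : ∀ k : Fin (n + 2) → Fin m,
      (∀ j, (k j : ℕ) = (if (j : ℕ) = 0 then m - 2 else m - 1)) ↔ k = i := fun k => by
    simp only [funext_iff, Fin.ext_iff, i, apply_ite Fin.val]
  have hl : ∀ k : Fin (n + 2) → Fin m, (∀ j, (k j : ℕ) = m - 1) ↔ k = l := fun k => by
    simp only [funext_iff, Fin.ext_iff, l]
  have hcell : ∀ (t : ℝ) (k : Fin (n + 2) → Fin m),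
      ProbabilityTheory.cond volume (OmegaStarSim m (n + 2) hd t k)
        = if k = i then cornerLaw m n (Omega1 t) else if k = l then cornerLaw m n (Omega2 t)
          else ProbabilityTheory.cond volume (gridCell m k) := fun t k => by
    simp only [OmegaStarSim, hi, hl]
    split_ifs <;> rfl
  have hcelli : ∀ t, ProbabilityTheory.cond volume (OmegaStarSim m (n + 2) hd t i)
      = cornerLaw m n (Omega1 t) := fun t => by rw [hcell, if_pos rfl]
  have hcelll : ∀ t, ProbabilityTheory.cond volume (OmegaStarSim m (n + 2) hd t l)
      = cornerLaw m n (Omega2 t) := fun t => by rw [hcell, if_neg hil.symm, if_pos rfl]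
  have := isProbabilityMeasure_cond_OmegaStarSim (by omega : 0 < m) hd hθ'
  have := isProbabilityMeasure_cond_OmegaStarSim (by omega : 0 < m) hd hπ
  refine integral_L2sq_pi_lt _ _ hil (fun k hki hkl => ?_) (fun z hz => ?_) ?_
  · simp only [hcell, hki, hkl, if_false]
  · simp only [hcelli, hcelll]
    exact cornerLaw_real_add hm2 hb hb' hz
  · simp only [hcelli, hcelll]
    have := isProbabilityMeasure_cornerLaw n (by omega : 0 < m) hb.volume_left
    have := isProbabilityMeasure_cornerLaw n (by omega : 0 < m) hb.volume_right
    have := isProbabilityMeasure_cornerLaw n (by omega : 0 < m) hb'.volume_left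
    have := isProbabilityMeasure_cornerLaw n (by omega : 0 < m) hb'.volume_right
    rw [integral_sub (integrableOn_real_lowerBox_mul _ _) (integrableOn_real_lowerBox_mul _ _),
      integral_cornerLaw_mul hm2 hb, integral_cornerLaw_mul hm2 hb', ← mul_sub, ← sub_mul]
    have hpos : 0 < m := by omega
    have := sub_pos.2 (crossIntegral_Omega_lt hθ)
    positivity
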